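/- For a probability measure P on ℝ define med(P) = inf{x : P((−∞, x]) ≥ 1/2}, I(P, λ) = [med(P) − λ, med(P) + λ], Δ(P, λ) = max{P({x}) : x ∈ I(P, λ)}, and MAD*(P) = min{λ ≥ 0 : P(I(P, λ)) ≥ (1 + Δ(P, λ))/2}. Then for every sample x_n = (x₁, …, x_n) in ℝ with empirical measure P_n, the finite-sample breakdown point of MAD* with respect to the scale pseudometric D(σ₁, σ₂) = |log(σ₁/σ₂)| equals ⌊(n − nΔ(P_n) + 1)/2⌋/n, where Δ(P_n) = max_x #{i : x_i = x}/n is the largest fraction of tied observations. -/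

import Mathlib

open MeasureTheory Set
open scoped NNReal ENNReal

/-- The empirical measure of a sample of size `n`. -/
noncomputable def empiricalMeasure {n : ℕ} (x : Fin n → ℝ) : Measure ℝ :=
  ((n : ℝ≥0∞))⁻¹ • ∑ i : Fin n, Measure.dirac (x i)

/-- The median `med(P) = inf{x : P((−∞, x]) ≥ 1/2}` of a probability measure on `ℝ`. -/
noncomputable def med (P : Measure ℝ) : ℝ :=
  sInf {t : ℝ | 1 / 2 ≤ (P (Set.Iic t)).toReal}

/-- The interval `I(P, λ) = [med(P) − λ, med(P) + λ]`. -/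
noncomputable def madInterval (P : Measure ℝ) (l : ℝ) : Set ℝ :=
  Set.Icc (med P - l) (med P + l)

/-- `Δ(P, λ) = max{P({x}) : x ∈ I(P, λ)}`. -/
noncomputable def madDelta (P : Measure ℝ) (l : ℝ) : ℝ :=
  sSup {r : ℝ | ∃ x ∈ madInterval P l, r = (P {x}).toReal}

/-- The modified MAD: `MAD*(P) = min{λ ≥ 0 : P(I(P, λ)) ≥ (1 + Δ(P, λ))/2}`. -/
noncomputable def MADstar (P : Measure ℝ) : ℝ :=
  sInf {l : ℝ | 0 ≤ l ∧ (1 + madDelta P l) / 2 ≤ (P (madInterval P l)).toReal}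

noncomputable def cntIn {n : ℕ} (y : Fin n → ℝ) (A : Set ℝ) : ℕ := by
  classical exact (Finset.univ.filter fun i => y i ∈ A).card

lemma emp_toReal {n : ℕ} (y : Fin n → ℝ) (A : Set ℝ) (hA : MeasurableSet A) :
    (empiricalMeasure y A).toReal = (cntIn y A : ℝ) / n := by
  classical
  unfold empiricalMeasure cntIn
  simp only [Measure.smul_apply, Measure.coe_finset_sum, Finset.sum_apply, smul_eq_mul,
    Measure.dirac_apply' _ hA, ENNReal.toReal_mul, ENNReal.toReal_inv, ENNReal.toReal_natCast]
  have : (∑ i : Fin n, A.indicator (1 : ℝ → ℝ≥0∞) (y i))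
      = ((Finset.univ.filter fun i => y i ∈ A).card : ℝ≥0∞) := by
    simp [Set.indicator_apply, Finset.sum_boole]
  rw [this, ENNReal.toReal_natCast]
  ring

lemma cntIn_mono {n : ℕ} (y : Fin n → ℝ) {A B : Set ℝ} (h : A ⊆ B) : cntIn y A ≤ cntIn y B := by
  classical
  unfold cntIn
  exact Finset.card_le_card (Finset.monotone_filter_right _ (fun i _ hi => h hi))

lemma cntIn_le {n : ℕ} (y : Fin n → ℝ) (A : Set ℝ) : cntIn y A ≤ n := by
  classical
  unfold cntIn
  exact (Finset.card_le_univ _).trans (by simp)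

lemma cntIn_disj {n : ℕ} (y : Fin n → ℝ) {A B : Set ℝ} (h : Disjoint A B) :
    cntIn y A + cntIn y B ≤ n := by
  classical
  unfold cntIn
  rw [← Finset.card_union_of_disjoint]
  · exact (Finset.card_le_univ _).trans (by simp)
  · rw [Finset.disjoint_left]
    intro i hi hj
    simp only [Finset.mem_filter, Finset.mem_univ, true_and] at hi hj
    exact Set.disjoint_left.1 h hi hj

lemma med_mem {n : ℕ} (hn : 0 < n) (y : Fin n → ℝ) (a b : ℝ)
    (h : n < 2 * cntIn y (Icc a b)) :
    med (empiricalMeasure y) ∈ Icc a b := by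
  have hn' : (0 : ℝ) < n := by exact_mod_cast hn
  have hset : {t : ℝ | 1 / 2 ≤ (empiricalMeasure y (Set.Iic t)).toReal}
      = {t : ℝ | n ≤ 2 * cntIn y (Iic t)} := by
    ext t
    simp only [mem_setOf_eq]
    rw [emp_toReal y _ measurableSet_Iic, div_le_div_iff₀ (by norm_num) hn']
    constructor
    · intro h
      have : (n : ℝ) ≤ 2 * cntIn y (Iic t) := by linarith
      exact_mod_cast this
    · intro h
      have : (n : ℝ) ≤ 2 * cntIn y (Iic t) := by exact_mod_cast h
      linarith
  unfold med
  rw [hset]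
  have hb : b ∈ {t : ℝ | n ≤ 2 * cntIn y (Iic t)} := by
    have := cntIn_mono y (Icc_subset_Iic_self : Icc a b ⊆ Iic b)
    simp only [mem_setOf_eq]; omega
  have ha : ∀ t ∈ {t : ℝ | n ≤ 2 * cntIn y (Iic t)}, a ≤ t := by
    intro t ht
    by_contra hlt
    push Not at hlt
    have := cntIn_disj y (A := Iic t) (B := Icc a b) (by
      rw [Set.disjoint_left]; intro z hz hz'
      have := hz'.1
      have h2 : z ≤ t := hz
      linarith)
    simp only [mem_setOf_eq] at ht
    omega
  exact ⟨le_csInf ⟨b, hb⟩ ha, csInf_le ⟨a, ha⟩ hb⟩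

lemma feas_mp {n : ℕ} (hn : 0 < n) (y : Fin n → ℝ) (l : ℝ)
    (h : (1 + madDelta (empiricalMeasure y) l) / 2 ≤
      (empiricalMeasure y (madInterval (empiricalMeasure y) l)).toReal)
    (w : ℝ) (hw : w ∈ madInterval (empiricalMeasure y) l) :
    n + cntIn y {w} ≤ 2 * cntIn y (madInterval (empiricalMeasure y) l) := by
  have hn' : (0 : ℝ) < n := by exact_mod_cast hn
  have h1 : (cntIn y {w} : ℝ) / n ≤ madDelta (empiricalMeasure y) l := by
    unfold madDelta
    apply le_csSup
    · refine ⟨1, ?_⟩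
      rintro r ⟨z, -, rfl⟩
      rw [emp_toReal y _ (measurableSet_singleton z), div_le_one hn']
      exact_mod_cast cntIn_le y _
    · exact ⟨w, hw, (emp_toReal y _ (measurableSet_singleton w)).symm⟩
  rw [emp_toReal y _ (by unfold madInterval; exact measurableSet_Icc)] at h
  have h2 : (1 + (cntIn y {w} : ℝ) / n) / 2 ≤
    (cntIn y (madInterval (empiricalMeasure y) l) : ℝ) / n := by linarith
  rw [le_div_iff₀ hn'] at h2
  have h3 : (1 + (cntIn y {w} : ℝ) / n) / 2 * n = (n + cntIn y {w}) / 2 := by field_simp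
  rw [h3] at h2
  have : (n : ℝ) + cntIn y {w} ≤ 2 * cntIn y (madInterval (empiricalMeasure y) l) := by linarith
  exact_mod_cast this

lemma feas_mpr {n : ℕ} (hn : 0 < n) (y : Fin n → ℝ) (l : ℝ) (hl : 0 ≤ l)
    (h : ∀ w ∈ madInterval (empiricalMeasure y) l,
      n + cntIn y {w} ≤ 2 * cntIn y (madInterval (empiricalMeasure y) l)) :
    l ∈ {l : ℝ | 0 ≤ l ∧ (1 + madDelta (empiricalMeasure y) l) / 2 ≤
      (empiricalMeasure y (madInterval (empiricalMeasure y) l)).toReal} := by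
  have hn' : (0 : ℝ) < n := by exact_mod_cast hn
  refine ⟨hl, ?_⟩
  have h1 : madDelta (empiricalMeasure y) l ≤
      (2 * (cntIn y (madInterval (empiricalMeasure y) l) : ℝ) - n) / n := by
    unfold madDelta
    apply csSup_le
    · refine ⟨_, med (empiricalMeasure y), ?_, rfl⟩
      unfold madInterval
      constructor <;> linarith
    · rintro r ⟨z, hz, rfl⟩
      rw [emp_toReal y _ (measurableSet_singleton z)]
      have : (n : ℝ) + cntIn y {z} ≤ 2 * cntIn y (madInterval (empiricalMeasure y) l) := by
        exact_mod_cast h z hz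
      gcongr
      linarith
  rw [emp_toReal y _ (by unfold madInterval; exact measurableSet_Icc)]
  have h3 : (2 * (cntIn y (madInterval (empiricalMeasure y) l) : ℝ) - n) / n
    = 2 * ((cntIn y (madInterval (empiricalMeasure y) l) : ℝ) / n) - 1 := by field_simp
  rw [h3] at h1
  linarith

lemma madstar_le {n : ℕ} (hn : 0 < n) (y : Fin n → ℝ) (l : ℝ) (hl : 0 ≤ l)
    (h : ∀ w ∈ madInterval (empiricalMeasure y) l,
      n + cntIn y {w} ≤ 2 * cntIn y (madInterval (empiricalMeasure y) l)) :
    MADstar (empiricalMeasure y) ≤ l :=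
  csInf_le ⟨0, fun _ h => h.1⟩ (feas_mpr hn y l hl h)

lemma exists_gap {n : ℕ} (x : Fin n → ℝ) :
    ∃ δ : ℝ, 0 < δ ∧ ∀ i j, x i ≠ x j → δ ≤ |x i - x j| := by
  classical
  let S : Finset ℝ := insert 1 ((Finset.univ.filter
    fun p : Fin n × Fin n => x p.1 ≠ x p.2).image fun p => |x p.1 - x p.2|)
  have hS : S.Nonempty := ⟨1, Finset.mem_insert_self _ _⟩
  refine ⟨S.min' hS, ?_, ?_⟩
  · rw [Finset.lt_min'_iff]
    intro z hz
    simp only [S, Finset.mem_insert, Finset.mem_image, Finset.mem_filter, Finset.mem_univ,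
      true_and] at hz
    rcases hz with rfl | ⟨p, hp, rfl⟩
    · norm_num
    · exact abs_pos.2 (sub_ne_zero.2 hp)
  · intro i j hij
    apply Finset.min'_le
    simp only [S, Finset.mem_insert, Finset.mem_image, Finset.mem_filter, Finset.mem_univ,
      true_and]
    exact Or.inr ⟨(i, j), hij, rfl⟩

lemma bounds {n : ℕ} (hn : 0 < n) (x : Fin n → ℝ) (m k : ℕ)
    (hm : ∀ w, cntIn x {w} ≤ m) (hk : 2 * k + m < n) :
    ∃ c C : ℝ, 0 < c ∧ ∀ y : Fin n → ℝ, {i | y i ≠ x i}.ncard ≤ k →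
      c ≤ MADstar (empiricalMeasure y) ∧ MADstar (empiricalMeasure y) ≤ C := by
  classical
  obtain ⟨δ, hδ, hgap⟩ := exists_gap x
  let B : ℝ := ∑ i, |x i|
  have hB : ∀ i, |x i| ≤ B := fun i =>
    Finset.single_le_sum (f := fun i => |x i|) (fun i _ => abs_nonneg _) (Finset.mem_univ i)
  have hB0 : 0 ≤ B := Finset.sum_nonneg fun i _ => abs_nonneg _
  refine ⟨δ / 3, 2 * B, by positivity, ?_⟩
  intro y hy
  have hD : (Finset.univ.filter fun i => y i ≠ x i).card ≤ k := by
    rw [← Set.ncard_coe_finset]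
    simpa using hy
  have hDc : (Finset.univ.filter fun i => y i = x i).card +
      (Finset.univ.filter fun i => y i ≠ x i).card = n := by
    have := Finset.card_filter_add_card_filter_not (s := (Finset.univ : Finset (Fin n)))
      (fun i => y i = x i)
    simpa using this
  -- splitting of counts
  have hsplit : ∀ A : Set ℝ, cntIn y A =
      (Finset.univ.filter fun i => y i ∈ A ∧ y i = x i).card +
      (Finset.univ.filter fun i => y i ∈ A ∧ y i ≠ x i).card := by
    intro A
    unfold cntIn
    rw [← Finset.card_filter_add_card_filter_not (s := Finset.univ.filter fun i => y i ∈ A)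
      (fun i => y i = x i), Finset.filter_filter, Finset.filter_filter]
  have hfix : ∀ A : Set ℝ, (Finset.univ.filter fun i => y i ∈ A ∧ y i ≠ x i).card ≤ k := by
    intro A
    refine le_trans (Finset.card_le_card ?_) hD
    intro i; simp only [Finset.mem_filter, Finset.mem_univ, true_and]; exact fun h => h.2
  have hfull : ∀ A : Set ℝ, Icc (-B) B ⊆ A →
      n ≤ (Finset.univ.filter fun i => y i ∈ A ∧ y i = x i).card + k := by
    intro A hA
    have : (Finset.univ.filter fun i => y i = x i).card ≤
        (Finset.univ.filter fun i => y i ∈ A ∧ y i = x i).card := by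
      apply Finset.card_le_card
      intro i; simp only [Finset.mem_filter, Finset.mem_univ, true_and]
      intro h
      refine ⟨hA ?_, h⟩
      rw [h]
      exact abs_le.1 (hB i)
    omega
  have hmed : med (empiricalMeasure y) ∈ Icc (-B) B := by
    apply med_mem hn
    have := hsplit (Icc (-B) B)
    have := hfull (Icc (-B) B) subset_rfl
    omega
  have hfeas : ∀ w ∈ madInterval (empiricalMeasure y) (2 * B),
      n + cntIn y {w} ≤ 2 * cntIn y (madInterval (empiricalMeasure y) (2 * B)) := by
    intro w hw
    obtain ⟨W, hW⟩ : ∃ W : Set ℝ, W = {w} := ⟨_, rfl⟩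
    rw [← hW]
    have h1 := hsplit W
    have h2 := hsplit (madInterval (empiricalMeasure y) (2 * B))
    have h3 := hfull (madInterval (empiricalMeasure y) (2 * B)) (by
      unfold madInterval
      apply Icc_subset_Icc <;> linarith [hmed.1, hmed.2])
    have h4 : (Finset.univ.filter fun i => y i ∈ W ∧ y i = x i).card ≤ m := by
      refine le_trans ?_ (hW ▸ hm w : cntIn x W ≤ m)
      unfold cntIn
      apply Finset.card_le_card
      intro i; simp only [Finset.mem_filter, Finset.mem_univ, true_and]
      rintro ⟨h, h'⟩
      rwa [h'] at h
    have h5 : (Finset.univ.filter fun i => y i ∈ W ∧ y i ≠ x i).card ≤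
        (Finset.univ.filter fun i =>
          y i ∈ madInterval (empiricalMeasure y) (2 * B) ∧ y i ≠ x i).card := by
      apply Finset.card_le_card
      intro i; simp only [Finset.mem_filter, Finset.mem_univ, true_and]
      rintro ⟨h, h'⟩
      refine ⟨?_, h'⟩
      rw [hW, mem_singleton_iff] at h
      rwa [h]
    omega
  refine ⟨?_, madstar_le hn y _ (by positivity) hfeas⟩
  apply le_csInf ⟨2 * B, feas_mpr hn y _ (by positivity) hfeas⟩
  rintro l ⟨hl, hl2⟩
  by_contra hlt
  push Not at hlt
  have key := feas_mp hn y l hl2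
  set J := madInterval (empiricalMeasure y) l with hJ
  have h2 := hsplit J
  have h3 := hfix J
  by_cases hne : ∃ i, y i ∈ J ∧ y i = x i
  · obtain ⟨i, hi, hix⟩ := hne
    have h1 := key (y i) hi
    have hsub : (Finset.univ.filter fun j => y j ∈ J ∧ y j = x j) ⊆
        Finset.univ.filter fun j => y j ∈ ({y i} : Set ℝ) ∧ x j ∈ ({y i} : Set ℝ) := by
      intro j; simp only [Finset.mem_filter, Finset.mem_univ, true_and, mem_singleton_iff]
      rintro ⟨hj, hjx⟩
      have : x j = x i := by
        by_contra hne
        have h := hgap j i hne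
        rw [← hjx, ← hix] at h
        have : |y j - y i| ≤ 2 * l := by
          rw [abs_le]
          rw [hJ] at hi hj
          unfold madInterval at hi hj
          constructor <;> linarith [hi.1, hi.2, hj.1, hj.2]
        linarith
      exact ⟨by rw [hjx, this, hix], by rw [this, hix]⟩
    have h4 : (Finset.univ.filter fun j => y j ∈ J ∧ y j = x j).card ≤ cntIn y {y i} := by
      refine (Finset.card_le_card hsub).trans ?_
      unfold cntIn
      apply Finset.card_le_card
      intro j; simp only [Finset.mem_filter, Finset.mem_univ, true_and]; exact fun h => h.1
    have h5 : (Finset.univ.filter fun j => y j ∈ J ∧ y j = x j).card ≤ m := by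
      refine (Finset.card_le_card hsub).trans (le_trans ?_ (hm (y i)))
      unfold cntIn
      apply Finset.card_le_card
      intro j; simp only [Finset.mem_filter, Finset.mem_univ, true_and]; exact fun h => h.2
    omega
  · push Not at hne
    have h4 : (Finset.univ.filter fun j => y j ∈ J ∧ y j = x j).card = 0 := by
      rw [Finset.card_eq_zero, Finset.filter_eq_empty_iff]
      intro i _ h
      exact hne i h.1 h.2
    have := key (med (empiricalMeasure y)) (by
      rw [hJ]; unfold madInterval; constructor <;> linarith)
    omega

lemma implode {n : ℕ} (hn : 0 < n) (x : Fin n → ℝ) (m k : ℕ) (v : ℝ)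
    (hm : ∀ w, cntIn x {w} ≤ m) (hv : cntIn x {v} = m) (hm0 : 0 < m) (hmn : m < n)
    (hk : n ≤ 2 * k + m) (hk2 : k + m ≤ n) :
    ∃ δ : ℝ, 0 < δ ∧ ∀ t, 0 < t → t < δ → ∃ y : Fin n → ℝ, {i | y i ≠ x i}.ncard ≤ k ∧
      0 < MADstar (empiricalMeasure y) ∧ MADstar (empiricalMeasure y) ≤ t := by
  classical
  have hn' : (0 : ℝ) < n := by exact_mod_cast hn
  obtain ⟨δ, hδ, hgap⟩ := exists_gap x
  refine ⟨δ, hδ, fun t ht htδ => ?_⟩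
  let F : Finset (Fin n) := Finset.univ.filter fun i => x i ∈ ({v} : Set ℝ)
  have hF : F.card = m := by rw [← hv]; unfold cntIn; rfl
  obtain ⟨i0, hi0⟩ : F.Nonempty := by rw [← Finset.card_pos]; omega
  have hi0v : x i0 = v := by simpa [F] using hi0
  obtain ⟨R, hRF, hRk⟩ : ∃ R ⊆ Fᶜ, R.card = k := Finset.exists_subset_card_eq (by
    rw [Finset.card_compl, Fintype.card_fin]; omega)
  let y : Fin n → ℝ := fun i => if i ∈ R then v + t * (((i : ℕ) + 1 : ℝ) / n) else x i
  have hyR : ∀ i ∈ R, y i = v + t * (((i : ℕ) + 1 : ℝ) / n) := fun i hi => if_pos hi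
  have hyN : ∀ i ∉ R, y i = x i := fun i hi => if_neg hi
  have hlo : ∀ i ∈ R, v < y i := by
    intro i hi; rw [hyR i hi]
    have : 0 < t * (((i : ℕ) + 1 : ℝ) / n) := by positivity
    linarith
  have hhi : ∀ i ∈ R, y i ≤ v + t := by
    intro i hi; rw [hyR i hi]
    have h1 : (((i : ℕ) + 1 : ℝ) / n) ≤ 1 := by
      rw [div_le_one hn']; exact_mod_cast i.2
    have : t * (((i : ℕ) + 1 : ℝ) / n) ≤ t * 1 := by gcongr
    linarith
  have hFR : Disjoint F R := by
    rw [Finset.disjoint_left]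
    intro i hi hi'
    exact (Finset.mem_compl.1 (hRF hi')) hi
  have hcl : m + k ≤ cntIn y (Icc v (v + t)) := by
    rw [← hF, ← hRk, ← Finset.card_union_of_disjoint hFR]
    unfold cntIn
    apply Finset.card_le_card
    intro i hi
    simp only [Finset.mem_filter, Finset.mem_univ, true_and]
    rcases Finset.mem_union.1 hi with hi | hi
    · rw [hyN i (Finset.disjoint_left.1 hFR hi)]
      have : x i = v := by simpa [F] using hi
      rw [this]; constructor <;> linarith
    · exact ⟨(hlo i hi).le, hhi i hi⟩
  have hties : ∀ w, cntIn y {w} ≤ m := by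
    intro w
    by_cases hw : ∃ i ∈ R, y i = w
    · obtain ⟨i, hi, rfl⟩ := hw
      refine le_trans ?_ (show 1 ≤ m from hm0)
      unfold cntIn
      haveI : Nonempty (Fin n) := ⟨i⟩
      rw [Finset.card_le_one_iff_subset_singleton]
      refine ⟨i, ?_⟩
      intro j
      simp only [Finset.mem_filter, Finset.mem_univ, true_and, mem_singleton_iff,
        Finset.mem_singleton]
      intro hj
      by_cases hjR : j ∈ R
      · rw [hyR i hi, hyR j hjR] at hj
        have h1 : (((j : ℕ) + 1 : ℝ) / n) = (((i : ℕ) + 1 : ℝ) / n) :=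
          mul_left_cancel₀ ht.ne' (by linarith)
        rw [div_left_inj' hn'.ne'] at h1
        have h2 : ((j : ℕ) : ℝ) = (i : ℕ) := by linarith
        exact Fin.ext (by exact_mod_cast h2)
      · exfalso
        rw [hyN j hjR] at hj
        have h1 := hlo i hi
        have h2 := hhi i hi
        have := hgap j i0 (by rw [hj, hi0v]; exact h1.ne')
        rw [hj, hi0v, abs_of_pos (by linarith)] at this
        linarith
    · push Not at hw
      refine le_trans ?_ (hm w)
      unfold cntIn
      apply Finset.card_le_card
      intro j
      simp only [Finset.mem_filter, Finset.mem_univ, true_and, mem_singleton_iff]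
      intro hj
      rw [← hyN j (fun h => hw j h hj), hj]
  refine ⟨y, ?_, ?_, ?_⟩
  · rw [← hRk, ← Set.ncard_coe_finset]
    apply Set.ncard_le_ncard _ (Finset.finite_toSet _)
    intro i hi
    by_contra h
    exact hi (hyN i (by simpa using h))
  · obtain ⟨c, C, hc, hb⟩ := bounds hn y m 0 hties (by omega)
    exact lt_of_lt_of_le hc (hb y (by simp)).1
  · have hmed := med_mem hn y v (v + t) (by omega)
    apply madstar_le hn y t ht.le
    intro w _
    have h1 := hties w
    have h2 : cntIn y (Icc v (v + t)) ≤ cntIn y (madInterval (empiricalMeasure y) t) := by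
      apply cntIn_mono
      unfold madInterval
      apply Icc_subset_Icc <;> linarith [hmed.1, hmed.2]
    omega

/-- **Davies–Gather, Section 5.2:** the finite-sample breakdown point of the modified
MAD with respect to the scale pseudometric `D(σ₁, σ₂) = |log(σ₁/σ₂)|` equals
`⌊(n − nΔ(Pₙ) + 1)/2⌋/n`, where `Δ(Pₙ)` is the largest fraction of tied observations;
i.e. `MAD*` attains the upper bound of Theorem 3.2. -/
theorem MADstar_fsbp
    (n : ℕ) (hn : 0 < n) (x : Fin n → ℝ) :
    ((sInf {k : ℕ | ∀ M : ℝ, ∃ y : Fin n → ℝ,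
        {i | y i ≠ x i}.ncard ≤ k ∧
        M < |Real.log (MADstar (empiricalMeasure x) / MADstar (empiricalMeasure y))|}
      : ℕ) : ℝ) / n =
    (⌊((n : ℝ) - n *
        (((Finset.univ.sup fun j : Fin n =>
          (Finset.univ.filter fun i : Fin n => x i = x j).card) : ℕ) : ℝ) / n + 1) / 2⌋₊
      : ℝ) / n := by
  have hn' : (0 : ℝ) < n := by exact_mod_cast hn
  set m : ℕ := Finset.univ.sup fun j : Fin n =>
          (Finset.univ.filter fun i : Fin n => x i = x j).card with hmdef
  have hcnt : ∀ j, cntIn x {x j} = (Finset.univ.filter fun i : Fin n => x i = x j).card := by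
    intro j
    unfold cntIn
    congr 1
  have hm : ∀ w, cntIn x {w} ≤ m := by
    intro w
    by_cases hw : ∃ j, x j = w
    · obtain ⟨j, rfl⟩ := hw
      rw [hcnt]
      exact Finset.le_sup (f := fun j : Fin n =>
          (Finset.univ.filter fun i : Fin n => x i = x j).card) (Finset.mem_univ j)
    · push Not at hw
      have : cntIn x {w} = 0 := by
        unfold cntIn
        rw [Finset.card_eq_zero, Finset.filter_eq_empty_iff]
        intro i _ h
        exact hw i h
      omega
  obtain ⟨j, -, hj⟩ := Finset.exists_mem_eq_sup (Finset.univ : Finset (Fin n))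
    ⟨⟨0, hn⟩, Finset.mem_univ _⟩ (fun j : Fin n =>
          (Finset.univ.filter fun i : Fin n => x i = x j).card)
  have hv : cntIn x {x j} = m := by rw [hcnt, hmdef, hj]
  have hm0 : 0 < m := by
    rw [← hv, hcnt, Finset.card_pos]
    exact ⟨j, by simp⟩
  have hmn : m ≤ n := hv ▸ cntIn_le x _
  have hR : ⌊((n : ℝ) - n * (m : ℝ) / n + 1) / 2⌋₊ = (n - m + 1) / 2 := by
    have : ((n : ℝ) - n * (m : ℝ) / n + 1) / 2 = ((n - m + 1 : ℕ) : ℝ) / (2 : ℕ) := by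
      push_cast [Nat.cast_sub hmn]
      field_simp
    rw [this, Nat.floor_div_eq_div]
  rw [hR]
  congr 2
  rcases hmn.eq_or_lt with heq | hlt
  · -- all tied
    have h0 : MADstar (empiricalMeasure x) = 0 := by
      apply le_antisymm
      · apply madstar_le hn x 0 le_rfl
        have hmed := med_mem hn x (x j) (x j) (by rw [Icc_self]; omega)
        rw [Icc_self, mem_singleton_iff] at hmed
        intro w _
        have : madInterval (empiricalMeasure x) 0 = {x j} := by
          unfold madInterval; rw [hmed]; simp
        rw [this, hv]
        have := hm w
        omega
      · exact Real.sInf_nonneg fun _ h => h.1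
    rw [h0, show (n - m + 1) / 2 = 0 by omega]
    simp only [zero_div, Real.log_zero, abs_zero]
    rw [Nat.sInf_eq_zero]
    right
    rw [Set.eq_empty_iff_forall_notMem]
    intro k hk
    obtain ⟨y, -, h⟩ := hk 0
    exact lt_irrefl _ h
  · have hx : 0 < MADstar (empiricalMeasure x) := by
      obtain ⟨c, C, hc, hb⟩ := bounds hn x m 0 hm (by omega)
      exact lt_of_lt_of_le hc (hb x (by simp)).1
    apply IsLeast.csInf_eq
    constructor
    · intro M
      obtain ⟨δ, hδ, h⟩ := implode hn x m ((n - m + 1) / 2) (x j) hm hv hm0 hlt (by omega)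
        (by omega)
      set s := MADstar (empiricalMeasure x)
      have he : 0 < s * Real.exp (-M - 1) := by positivity
      obtain ⟨y, hy, hy0, hyt⟩ := h (min (δ / 2) (s * Real.exp (-M - 1)))
        (lt_min (by positivity) he) ((min_le_left _ _).trans_lt (by linarith))
      refine ⟨y, hy, lt_of_lt_of_le ?_ (le_abs_self _)⟩
      have h1 := Real.log_le_log hy0 (hyt.trans (min_le_right _ _))
      rw [Real.log_mul hx.ne' (Real.exp_pos _).ne', Real.log_exp] at h1
      rw [Real.log_div hx.ne' hy0.ne']
      linarith
    · intro k hk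
      by_contra hlt2
      push Not at hlt2
      obtain ⟨c, C, hc, hb⟩ := bounds hn x m k hm (by omega)
      set s := MADstar (empiricalMeasure x)
      obtain ⟨y, hy, hM⟩ := hk (|Real.log s| + (|Real.log c| + |Real.log C|))
      obtain ⟨h1, h2⟩ := hb y hy
      have hy0 := lt_of_lt_of_le hc h1
      rw [Real.log_div hx.ne' hy0.ne'] at hM
      have h3 := Real.log_le_log hc h1
      have h4 := Real.log_le_log hy0 h2
      have h5 : |Real.log (MADstar (empiricalMeasure y))| ≤ |Real.log c| + |Real.log C| := by
        rw [abs_le]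
        constructor <;> linarith [neg_abs_le (Real.log c), le_abs_self (Real.log C),
          abs_nonneg (Real.log c), abs_nonneg (Real.log C)]
      have h6 := abs_sub (Real.log s) (Real.log (MADstar (empiricalMeasure y)))
      linarith
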